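/- Case 7 of Theorem 1.2: the hypergeometric group Γ(f,g) generated by the companion matrices A and B of f(x) = x^5 + x^4 + x^3 - x^2 - x - 1 and g(x) = x^5 + x^4 + x + 1 is an arithmetic subgroup of the integral orthogonal group O_Q(ℤ): Γ(f,g) is contained in O_Q(ℤ) (in particular Aᵀ·Q·A = Q and Bᵀ·Q·B = Q), and Γ(f,g) has finite index in O_Q(ℤ). -/

import Mathlib

open Matrix

/-- The companion matrix `A` of `f(x) = x^5 + x^4 + x^3 - x^2 - x - 1`. -/
def matA : Matrix (Fin 5) (Fin 5) ℤ :=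
  !![(0 : ℤ), 0, 0, 0, 1; 1, 0, 0, 0, 1; 0, 1, 0, 0, 1; 0, 0, 1, 0, -1; 0, 0, 0, 1, -1]

/-- The companion matrix `B` of `g(x) = x^5 + x^4 + x + 1`. -/
def matB : Matrix (Fin 5) (Fin 5) ℤ :=
  !![(0 : ℤ), 0, 0, 0, -1; 1, 0, 0, 0, -1; 0, 1, 0, 0, 0; 0, 0, 1, 0, 0; 0, 0, 0, 1, -1]

/-- The symmetric integer matrix `Q` of the quadratic form preserved by `Γ(f,g)`. -/
def matQ : Matrix (Fin 5) (Fin 5) ℤ :=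
  !![(7 : ℤ), -5, -1, 7, -9; -5, 7, -5, -1, 7; -1, -5, 7, -5, -1; 7, -1, -5, 7, -5; -9, 7, -1, -5, 7]

/-- The integral orthogonal group `O_Q(ℤ)` of a matrix `Q`, as the subgroup of `GL₅(ℤ)`
consisting of all `M` with `Mᵀ * Q * M = Q`. -/
def orthogonalSubgroup (Q : Matrix (Fin 5) (Fin 5) ℤ) : Subgroup (GL (Fin 5) ℤ) where
  carrier := { M : GL (Fin 5) ℤ |
      (M : Matrix (Fin 5) (Fin 5) ℤ)ᵀ * Q * (M : Matrix (Fin 5) (Fin 5) ℤ) = Q }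
  one_mem' := by simp
  mul_mem' := by
    intro a b ha hb
    simp only [Set.mem_setOf_eq, Units.val_mul, transpose_mul] at ha hb ⊢
    calc ((b : Matrix (Fin 5) (Fin 5) ℤ)ᵀ * (a : Matrix (Fin 5) (Fin 5) ℤ)ᵀ) * Q *
          ((a : Matrix (Fin 5) (Fin 5) ℤ) * (b : Matrix (Fin 5) (Fin 5) ℤ))
        = (b : Matrix (Fin 5) (Fin 5) ℤ)ᵀ *
            ((a : Matrix (Fin 5) (Fin 5) ℤ)ᵀ * Q * (a : Matrix (Fin 5) (Fin 5) ℤ)) *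
            (b : Matrix (Fin 5) (Fin 5) ℤ) := by
          simp only [mul_assoc]
      _ = Q := by rw [ha, hb]
  inv_mem' := by
    intro a ha
    simp only [Set.mem_setOf_eq] at ha ⊢
    calc ((a⁻¹ : GL (Fin 5) ℤ) : Matrix (Fin 5) (Fin 5) ℤ)ᵀ * Q *
          ((a⁻¹ : GL (Fin 5) ℤ) : Matrix (Fin 5) (Fin 5) ℤ)
        = ((a⁻¹ : GL (Fin 5) ℤ) : Matrix (Fin 5) (Fin 5) ℤ)ᵀ *
            ((a : Matrix (Fin 5) (Fin 5) ℤ)ᵀ * Q * (a : Matrix (Fin 5) (Fin 5) ℤ)) *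
            ((a⁻¹ : GL (Fin 5) ℤ) : Matrix (Fin 5) (Fin 5) ℤ) := by rw [ha]
      _ = ((a : Matrix (Fin 5) (Fin 5) ℤ) *
            ((a⁻¹ : GL (Fin 5) ℤ) : Matrix (Fin 5) (Fin 5) ℤ))ᵀ * Q *
          ((a : Matrix (Fin 5) (Fin 5) ℤ) *
            ((a⁻¹ : GL (Fin 5) ℤ) : Matrix (Fin 5) (Fin 5) ℤ)) := by
          simp only [transpose_mul, mul_assoc]
      _ = Q := by rw [Units.mul_inv]; simp


/-! ### Coordinates in which the form is `8 (x₁ x₂ + x₃ x₄) - x₅ ^ 2` -/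

abbrev Mat5 := Matrix (Fin 5) (Fin 5) ℤ

def mX13 (k : ℤ) : Mat5 :=
  !![1, 0, k, 0, 0; 0, 1, 0, 0, 0; 0, 0, 1, 0, 0; 0, -k, 0, 1, 0; 0, 0, 0, 0, 1]
def mX14 (k : ℤ) : Mat5 :=
  !![1, 0, 0, k, 0; 0, 1, 0, 0, 0; 0, -k, 1, 0, 0; 0, 0, 0, 1, 0; 0, 0, 0, 0, 1]
def mX31 (k : ℤ) : Mat5 :=
  !![1, 0, 0, 0, 0; 0, 1, 0, -k, 0; k, 0, 1, 0, 0; 0, 0, 0, 1, 0; 0, 0, 0, 0, 1]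
def mX41 (k : ℤ) : Mat5 :=
  !![1, 0, 0, 0, 0; 0, 1, -k, 0, 0; 0, 0, 1, 0, 0; k, 0, 0, 1, 0; 0, 0, 0, 0, 1]
def mH1 (k : ℤ) : Mat5 :=
  !![1, 2*k^2, 0, 0, k; 0, 1, 0, 0, 0; 0, 0, 1, 0, 0; 0, 0, 0, 1, 0; 0, 4*k, 0, 0, 1]
def mH2 (k : ℤ) : Mat5 :=
  !![1, 0, 0, 0, 0; 2*k^2, 1, 0, 0, k; 0, 0, 1, 0, 0; 0, 0, 0, 1, 0; 4*k, 0, 0, 0, 1]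
def mH3 (k : ℤ) : Mat5 :=
  !![1, 0, 0, 0, 0; 0, 1, 0, 0, 0; 0, 0, 1, 2*k^2, k; 0, 0, 0, 1, 0; 0, 0, 0, 4*k, 1]
def mH4 (k : ℤ) : Mat5 :=
  !![1, 0, 0, 0, 0; 0, 1, 0, 0, 0; 0, 0, 1, 0, 0; 0, 0, 2*k^2, 1, k; 0, 0, 4*k, 0, 1]
def mS12 : Mat5 :=
  !![0, 1, 0, 0, 0; 1, 0, 0, 0, 0; 0, 0, 1, 0, 0; 0, 0, 0, 1, 0; 0, 0, 0, 0, 1]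
def mS34 : Mat5 :=
  !![1, 0, 0, 0, 0; 0, 1, 0, 0, 0; 0, 0, 0, 1, 0; 0, 0, 1, 0, 0; 0, 0, 0, 0, 1]
def mW : Mat5 :=
  !![0, 0, 1, 0, 0; 0, 0, 0, 1, 0; -1, 0, 0, 0, 0; 0, -1, 0, 0, 0; 0, 0, 0, 0, 1]

theorem add_X13 (k l : ℤ) : mX13 k * mX13 l = mX13 (k + l) := by
  ext i j; fin_cases i <;> fin_cases j <;> simp [mX13, Matrix.mul_apply, Fin.sum_univ_five] <;> ring
theorem add_X14 (k l : ℤ) : mX14 k * mX14 l = mX14 (k + l) := by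
  ext i j; fin_cases i <;> fin_cases j <;> simp [mX14, Matrix.mul_apply, Fin.sum_univ_five] <;> ring
theorem add_X31 (k l : ℤ) : mX31 k * mX31 l = mX31 (k + l) := by
  ext i j; fin_cases i <;> fin_cases j <;> simp [mX31, Matrix.mul_apply, Fin.sum_univ_five] <;> ring
theorem add_X41 (k l : ℤ) : mX41 k * mX41 l = mX41 (k + l) := by
  ext i j; fin_cases i <;> fin_cases j <;> simp [mX41, Matrix.mul_apply, Fin.sum_univ_five] <;> ring
theorem add_H1 (k l : ℤ) : mH1 k * mH1 l = mH1 (k + l) := by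
  ext i j; fin_cases i <;> fin_cases j <;> simp [mH1, Matrix.mul_apply, Fin.sum_univ_five] <;> ring
theorem add_H2 (k l : ℤ) : mH2 k * mH2 l = mH2 (k + l) := by
  ext i j; fin_cases i <;> fin_cases j <;> simp [mH2, Matrix.mul_apply, Fin.sum_univ_five] <;> ring
theorem add_H3 (k l : ℤ) : mH3 k * mH3 l = mH3 (k + l) := by
  ext i j; fin_cases i <;> fin_cases j <;> simp [mH3, Matrix.mul_apply, Fin.sum_univ_five] <;> ring
theorem add_H4 (k l : ℤ) : mH4 k * mH4 l = mH4 (k + l) := by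
  ext i j; fin_cases i <;> fin_cases j <;> simp [mH4, Matrix.mul_apply, Fin.sum_univ_five] <;> ring

/-- Membership of an integral matrix in a subgroup of `GL₅(ℤ)`. -/
def MemM (H : Subgroup (GL (Fin 5) ℤ)) (m : Mat5) : Prop := ∃ g ∈ H, (g : Mat5) = m

theorem MemM.mul {H : Subgroup (GL (Fin 5) ℤ)} {m n : Mat5} (hm : MemM H m) (hn : MemM H n) :
    MemM H (m * n) := by
  obtain ⟨g, hg, rfl⟩ := hm
  obtain ⟨k, hk, rfl⟩ := hn
  exact ⟨g * k, H.mul_mem hg hk, by simp⟩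

theorem MemM.inv {H : Subgroup (GL (Fin 5) ℤ)} {m n : Mat5} (hm : MemM H m) (h : m * n = 1) :
    MemM H n := by
  obtain ⟨g, hg, rfl⟩ := hm
  refine ⟨g⁻¹, H.inv_mem hg, ?_⟩
  calc ((g⁻¹ : GL (Fin 5) ℤ) : Mat5) = ((g⁻¹ : GL (Fin 5) ℤ) : Mat5) * ((g : Mat5) * n) := by
        rw [h, mul_one]
    _ = n := by rw [← mul_assoc, Units.inv_mul, one_mul]

theorem MemM.one {H : Subgroup (GL (Fin 5) ℤ)} : MemM H 1 := ⟨1, H.one_mem, rfl⟩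

/-- A one-parameter family lies in the subgroup as soon as its generator does. -/
theorem MemM.family {H : Subgroup (GL (Fin 5) ℤ)} (m : ℤ → Mat5)
    (hadd : ∀ k l, m k * m l = m (k + l)) (h0 : m 0 = 1) (h1 : MemM H (m 1)) (k : ℤ) :
    MemM H (m k) := by
  have hm1 : MemM H (m (-1)) := h1.inv (by rw [hadd]; simpa using h0)
  induction k using Int.induction_on with
  | zero => rw [h0]; exact MemM.one
  | succ i ih => rw [← hadd]; exact ih.mul h1
  | pred i ih => rw [sub_eq_add_neg, ← hadd]; exact ih.mul hm1

/-- The subgroup contains all the elementary matrices used in the reduction. -/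
structure Good (H : Subgroup (GL (Fin 5) ℤ)) : Prop where
  X13 : ∀ k, MemM H (mX13 k)
  X14 : ∀ k, MemM H (mX14 k)
  X31 : ∀ k, MemM H (mX31 k)
  X41 : ∀ k, MemM H (mX41 k)
  H1 : ∀ k, MemM H (mH1 k)
  H2 : ∀ k, MemM H (mH2 k)
  H3 : ∀ k, MemM H (mH3 k)
  H4 : ∀ k, MemM H (mH4 k)
  S12 : MemM H mS12
  S34 : MemM H mS34
  W : MemM H mW

/-- Four elements suffice. -/
theorem Good.of_four {H : Subgroup (GL (Fin 5) ℤ)} (h12 : MemM H mS12) (h34 : MemM H mS34)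
    (h14 : MemM H (mX14 (-1))) (h3 : MemM H (mH3 1)) : Good H := by
  have z13 : mX13 0 = 1 := by decide
  have z14 : mX14 0 = 1 := by decide
  have z31 : mX31 0 = 1 := by decide
  have z41 : mX41 0 = 1 := by decide
  have zH1 : mH1 0 = 1 := by decide
  have zH2 : mH2 0 = 1 := by decide
  have zH3 : mH3 0 = 1 := by decide
  have zH4 : mH4 0 = 1 := by decide
  have X14 : ∀ k, MemM H (mX14 k) := MemM.family _ add_X14 z14 (h14.inv (by decide))
  have X13 : ∀ k, MemM H (mX13 k) := MemM.family _ add_X13 z13 (by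
    have h : mS34 * mX14 1 * mS34 = mX13 1 := by decide
    exact h ▸ (h34.mul (X14 1)).mul h34)
  have X31 : ∀ k, MemM H (mX31 k) := MemM.family _ add_X31 z31 (by
    have h : mS12 * mX14 (-1) * mS12 = mX31 1 := by decide
    exact h ▸ (h12.mul (X14 (-1))).mul h12)
  have X41 : ∀ k, MemM H (mX41 k) := MemM.family _ add_X41 z41 (by
    have h : mS12 * mX13 (-1) * mS12 = mX41 1 := by decide
    exact h ▸ (h12.mul (X13 (-1))).mul h12)
  have W : MemM H mW := by
    have h : mX13 1 * mX31 (-1) * mX13 1 = mW := by decide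
    exact h ▸ ((X13 1).mul (X31 (-1))).mul (X13 1)
  have Wi : MemM H mWᵀ := W.inv (by decide)
  have H3 : ∀ k, MemM H (mH3 k) := MemM.family _ add_H3 zH3 h3
  have H4 : ∀ k, MemM H (mH4 k) := MemM.family _ add_H4 zH4 (by
    have h : mS34 * mH3 1 * mS34 = mH4 1 := by decide
    exact h ▸ (h34.mul h3).mul h34)
  have H1 : ∀ k, MemM H (mH1 k) := MemM.family _ add_H1 zH1 (by
    have h : mW * mH3 1 * mWᵀ = mH1 1 := by decide
    exact h ▸ (W.mul h3).mul Wi)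
  have H2 : ∀ k, MemM H (mH2 k) := MemM.family _ add_H2 zH2 (by
    have h : mS12 * mH1 1 * mS12 = mH2 1 := by decide
    exact h ▸ (h12.mul (H1 1)).mul h12)
  exact ⟨X13, X14, X31, X41, H1, H2, H3, H4, h12, h34, W⟩

section action
variable (k x y z w h : ℤ)

theorem act_X13 : mX13 k *ᵥ ![x, y, z, w, h] = ![x + k*z, y, z, w - k*y, h] := by
  ext i; fin_cases i <;> simp [mX13, Matrix.mulVec, dotProduct, Fin.sum_univ_five] <;> ring
theorem act_X14 : mX14 k *ᵥ ![x, y, z, w, h] = ![x + k*w, y, z - k*y, w, h] := by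
  ext i; fin_cases i <;> simp [mX14, Matrix.mulVec, dotProduct, Fin.sum_univ_five] <;> ring
theorem act_X31 : mX31 k *ᵥ ![x, y, z, w, h] = ![x, y - k*w, z + k*x, w, h] := by
  ext i; fin_cases i <;> simp [mX31, Matrix.mulVec, dotProduct, Fin.sum_univ_five] <;> ring
theorem act_X41 : mX41 k *ᵥ ![x, y, z, w, h] = ![x, y - k*z, z, w + k*x, h] := by
  ext i; fin_cases i <;> simp [mX41, Matrix.mulVec, dotProduct, Fin.sum_univ_five] <;> ring
theorem act_H1 : mH1 k *ᵥ ![x, y, z, w, h] = ![x + k*h + 2*k^2*y, y, z, w, h + 4*k*y] := by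
  ext i; fin_cases i <;> simp [mH1, Matrix.mulVec, dotProduct, Fin.sum_univ_five] <;> ring
theorem act_H2 : mH2 k *ᵥ ![x, y, z, w, h] = ![x, y + k*h + 2*k^2*x, z, w, h + 4*k*x] := by
  ext i; fin_cases i <;> simp [mH2, Matrix.mulVec, dotProduct, Fin.sum_univ_five] <;> ring
theorem act_H3 : mH3 k *ᵥ ![x, y, z, w, h] = ![x, y, z + k*h + 2*k^2*w, w, h + 4*k*w] := by
  ext i; fin_cases i <;> simp [mH3, Matrix.mulVec, dotProduct, Fin.sum_univ_five] <;> ring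
theorem act_H4 : mH4 k *ᵥ ![x, y, z, w, h] = ![x, y, z, w + k*h + 2*k^2*z, h + 4*k*z] := by
  ext i; fin_cases i <;> simp [mH4, Matrix.mulVec, dotProduct, Fin.sum_univ_five] <;> ring
theorem act_S12 : mS12 *ᵥ ![x, y, z, w, h] = ![y, x, z, w, h] := by
  ext i; fin_cases i <;> simp [mS12, Matrix.mulVec, dotProduct, Fin.sum_univ_five]
theorem act_S34 : mS34 *ᵥ ![x, y, z, w, h] = ![x, y, w, z, h] := by
  ext i; fin_cases i <;> simp [mS34, Matrix.mulVec, dotProduct, Fin.sum_univ_five]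
theorem act_W : mW *ᵥ ![x, y, z, w, h] = ![z, w, -x, -y, h] := by
  ext i; fin_cases i <;> simp [mW, Matrix.mulVec, dotProduct, Fin.sum_univ_five]

end action

/-- `v` can be moved to a multiple of the first basis vector. -/
def Red (H : Subgroup (GL (Fin 5) ℤ)) (v : Fin 5 → ℤ) : Prop :=
  ∃ m, MemM H m ∧ ∃ g : ℤ, m *ᵥ v = ![g, 0, 0, 0, 0]

theorem Red.step {H : Subgroup (GL (Fin 5) ℤ)} {m : Mat5} {v v₁ : Fin 5 → ℤ} (hm : MemM H m)
    (h : m *ᵥ v = v₁) (hr : Red H v₁) : Red H v := by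
  obtain ⟨n, hn, g, hg⟩ := hr
  exact ⟨n * m, hn.mul hm, g, by rw [← Matrix.mulVec_mulVec, h, hg]⟩

/-- Balanced reduction of the last coordinate. -/
theorem exists_balanced (h x : ℤ) (hx : x ≠ 0) : ∃ k : ℤ, (h + 4 * k * x) ^ 2 ≤ 4 * x ^ 2 := by
  have key : ∀ x : ℤ, 0 < x → ∃ k : ℤ, (h + 4 * k * x) ^ 2 ≤ 4 * x ^ 2 := by
    intro x hx
    refine ⟨-((h + 2 * x) / (4 * x)), ?_⟩
    have h1 := Int.emod_add_mul_ediv (h + 2 * x) (4 * x)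
    have h2 := Int.emod_nonneg (h + 2 * x) (show 4 * x ≠ 0 by omega)
    have h3 := Int.emod_lt_of_pos (h + 2 * x) (show 0 < 4 * x by omega)
    have h4 : h + 4 * -((h + 2 * x) / (4 * x)) * x = (h + 2 * x) % (4 * x) - 2 * x := by
      linear_combination -h1
    rw [h4]
    nlinarith
  rcases lt_or_gt_of_ne hx with h0 | h0
  · obtain ⟨k, hk⟩ := key (-x) (by omega)
    exact ⟨-k, by nlinarith⟩
  · exact key x h0

theorem red_of_ne {H : Subgroup (GL (Fin 5) ℤ)} (hH : Good H) (n : ℕ) :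
    ∀ x y z w h : ℤ, x ≠ 0 → x.natAbs = n → 8 * (x * y + z * w) = h ^ 2 →
      Red H ![x, y, z, w, h] := by
  induction n using Nat.strong_induction_on with
  | _ n ih =>
  -- first the case where the third coordinate is not a multiple of the first one
  have case3 : ∀ x y z w h : ℤ, x ≠ 0 → x.natAbs = n → 8 * (x * y + z * w) = h ^ 2 →
      ¬ x ∣ z → Red H ![x, y, z, w, h] := by
    intro x y z w h hx hn hq hd
    have e1 := Int.emod_add_mul_ediv z x
    have e2 := Int.emod_nonneg z hx
    have e3 := Int.emod_lt_abs z hx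
    have e4 : z % x ≠ 0 := fun h0 => hd (Int.dvd_of_emod_eq_zero h0)
    have e5 : z + -(z / x) * x = z % x := by linear_combination -e1
    refine Red.step (hH.X31 (-(z / x))) (act_X31 _ _ _ _ _ _) ?_
    rw [e5]
    refine Red.step hH.W (act_W _ _ _ _ _) ?_
    refine ih (z % x).natAbs (by rw [Int.abs_eq_natAbs] at e3; omega) _ _ _ _ _ e4 rfl ?_
    linear_combination hq + 8 * w * e1
  intro x y z w h hx hn hq
  by_cases h3 : x ∣ z
  swap
  · exact case3 x y z w h hx hn hq h3
  by_cases h4 : x ∣ w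
  swap
  · refine Red.step hH.S34 (act_S34 _ _ _ _ _) ?_
    exact case3 x y w z h hx hn (by linear_combination hq) h4
  obtain ⟨c, rfl⟩ := h3
  obtain ⟨d, rfl⟩ := h4
  refine Red.step (hH.X31 (-c)) (act_X31 _ _ _ _ _ _) ?_
  rw [show x * c + -c * x = 0 by ring]
  refine Red.step (hH.X41 (-d)) (act_X41 _ _ _ _ _ _) ?_
  rw [show x * d + -d * x = 0 by ring]
  obtain ⟨k, hk⟩ := exists_balanced h x hx
  refine Red.step (hH.H2 k) (act_H2 _ _ _ _ _ _) ?_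
  set y1 := y - -c * (x * d) - -d * 0 + k * h + 2 * k ^ 2 * x with hy1
  set h1 := h + 4 * k * x with hh1
  have hq1 : 8 * (x * y1) = h1 ^ 2 := by rw [hy1, hh1]; linear_combination hq
  by_cases hy : y1 = 0
  · have : h1 = 0 := by
      rw [hy] at hq1
      exact pow_eq_zero_iff (two_ne_zero) |>.1 (by linarith)
    rw [hy, this]
    exact ⟨1, MemM.one, x, by simp⟩
  · refine Red.step hH.S12 (act_S12 _ _ _ _ _) ?_
    have hlt : |y1| < |x| := by
      have hxy : 8 * (|x| * |y1|) ≤ 4 * |x| ^ 2 := by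
        rw [← abs_mul, sq_abs]
        have : |x * y1| = x * y1 := abs_of_nonneg (by nlinarith [sq_nonneg h1])
        rw [this]; linarith
      have hx0 : 0 < |x| := abs_pos.2 hx
      have : 0 < |y1| := abs_pos.2 hy
      nlinarith
    refine ih y1.natAbs (by rw [Int.abs_eq_natAbs, Int.abs_eq_natAbs] at hlt; omega)
      _ _ _ _ _ hy rfl (by linear_combination hq1)

theorem red_all {H : Subgroup (GL (Fin 5) ℤ)} (hH : Good H) (x y z w h : ℤ)
    (hq : 8 * (x * y + z * w) = h ^ 2) : Red H ![x, y, z, w, h] := by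
  by_cases hx : x = 0
  swap
  · exact red_of_ne hH _ _ _ _ _ _ hx rfl hq
  by_cases hy : y = 0
  swap
  · exact Red.step hH.S12 (act_S12 _ _ _ _ _)
      (red_of_ne hH _ _ _ _ _ _ hy rfl (by linear_combination hq))
  have step3 : ∀ z w : ℤ, 8 * (x * y + z * w) = h ^ 2 → z ≠ 0 → Red H ![x, y, z, w, h] := by
    intro z w hq hz
    exact Red.step hH.W (act_W _ _ _ _ _)
      (red_of_ne hH _ _ _ _ _ _ hz rfl (by linear_combination hq))
  by_cases hz : z = 0
  swap
  · exact step3 z w hq hz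
  by_cases hw : w = 0
  swap
  · exact Red.step hH.S34 (act_S34 _ _ _ _ _) (step3 w z (by linear_combination hq) hw)
  subst hx hy hz hw
  have : h = 0 := pow_eq_zero_iff (two_ne_zero) |>.1 (by linarith)
  subst this
  exact ⟨1, MemM.one, 0, by simp⟩

/-- The rank three reduction, inside the stabilizer of the first two basis vectors. -/
theorem red_three {H : Subgroup (GL (Fin 5) ℤ)} (hH : Good H) (n : ℕ) :
    ∀ z w h : ℤ, z ≠ 0 → z.natAbs = n → 8 * (z * w) = h ^ 2 →
      ∃ m, MemM H m ∧ (∀ s t : ℤ, m *ᵥ ![s, t, 0, 0, 0] = ![s, t, 0, 0, 0]) ∧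
        ∃ g : ℤ, m *ᵥ ![0, 0, z, w, h] = ![0, 0, g, 0, 0] := by
  induction n using Nat.strong_induction_on with
  | _ n ih =>
  intro x y h hx hn hq
  obtain ⟨k, hk⟩ := exists_balanced h x hx
  set y1 := y + k * h + 2 * k ^ 2 * x with hy1
  set h1 := h + 4 * k * x with hh1
  have hq1 : 8 * (x * y1) = h1 ^ 2 := by rw [hy1, hh1]; linear_combination hq
  by_cases hy : y1 = 0
  · have h10 : h1 = 0 := by
      rw [hy] at hq1
      exact pow_eq_zero_iff (two_ne_zero) |>.1 (by linarith)
    refine ⟨mH4 k, hH.H4 k, fun s t => by rw [act_H4]; simp, x, ?_⟩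
    rw [act_H4, ← hy1, ← hh1, hy, h10]
  · have hlt : |y1| < |x| := by
      have hxy : 8 * (|x| * |y1|) ≤ 4 * |x| ^ 2 := by
        rw [← abs_mul, sq_abs]
        have : |x * y1| = x * y1 := abs_of_nonneg (by nlinarith [sq_nonneg h1])
        rw [this]; linarith
      have hx0 : 0 < |x| := abs_pos.2 hx
      have : 0 < |y1| := abs_pos.2 hy
      nlinarith
    obtain ⟨m, hm, hst, g, hg⟩ := ih y1.natAbs
      (by rw [Int.abs_eq_natAbs, Int.abs_eq_natAbs] at hlt; omega)
      y1 x h1 hy rfl (by linear_combination hq1)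
    refine ⟨m * (mS34 * mH4 k), hm.mul (hH.S34.mul (hH.H4 k)), fun s t => ?_, g, ?_⟩
    · rw [← Matrix.mulVec_mulVec, ← Matrix.mulVec_mulVec, act_H4, act_S34]
      simpa using hst s t
    · rw [← Matrix.mulVec_mulVec, ← Matrix.mulVec_mulVec, act_H4, act_S34, ← hy1, ← hh1, hg]

/-- The matrix of the form in the new coordinates. -/
def matQ1 : Mat5 :=
  !![0, 4, 0, 0, 0; 4, 0, 0, 0, 0; 0, 0, 0, 4, 0; 0, 0, 4, 0, 0; 0, 0, 0, 0, -1]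

def IsOrth (m : Mat5) : Prop := mᵀ * matQ1 * m = matQ1

theorem IsOrth.mul {m n : Mat5} (hm : IsOrth m) (hn : IsOrth n) : IsOrth (m * n) := by
  unfold IsOrth at *
  calc (m * n)ᵀ * matQ1 * (m * n) = nᵀ * (mᵀ * matQ1 * m) * n := by
        simp only [Matrix.transpose_mul, mul_assoc]
    _ = matQ1 := by rw [hm, hn]

theorem IsOrth.bil {m : Mat5} (hm : IsOrth m) (u v : Fin 5 → ℤ) {a b c d e a₁ b₁ c₁ d₁ e₁ : ℤ}
    (hu : m *ᵥ u = ![a, b, c, d, e]) (hv : m *ᵥ v = ![a₁, b₁, c₁, d₁, e₁]) :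
    4 * (a * b₁ + b * a₁ + c * d₁ + d * c₁) - e * e₁ =
      4 * (u 0 * v 1 + u 1 * v 0 + u 2 * v 3 + u 3 * v 2) - u 4 * v 4 := by
  have key : ∀ u v : Fin 5 → ℤ, u ⬝ᵥ (matQ1 *ᵥ v) =
      4 * (u 0 * v 1 + u 1 * v 0 + u 2 * v 3 + u 3 * v 2) - u 4 * v 4 := by
    intro u v
    simp [matQ1, Matrix.mulVec, dotProduct, Fin.sum_univ_five]
    ring
  have h1 : (m *ᵥ u) ⬝ᵥ (matQ1 *ᵥ (m *ᵥ v)) = u ⬝ᵥ (matQ1 *ᵥ v) := by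
    conv_rhs => rw [← hm]
    rw [← Matrix.mulVec_mulVec, ← Matrix.mulVec_mulVec, Matrix.dotProduct_mulVec u mᵀ,
      Matrix.vecMul_transpose]
  rw [key, key, hu, hv] at h1
  simpa using h1

theorem vec_eta (v : Fin 5 → ℤ) : v = ![v 0, v 1, v 2, v 3, v 4] := by
  ext i; fin_cases i <;> rfl

theorem four_dvd_of_sq {h t : ℤ} (hq : 8 * t = h ^ 2) : ∃ k, h = 4 * k := by
  have h2 : (2 : ℤ) ∣ h := Int.prime_two.dvd_of_dvd_pow (n := 2) ⟨4 * t, by linarith⟩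
  obtain ⟨c, rfl⟩ := h2
  have h3 : (2 : ℤ) ∣ c := Int.prime_two.dvd_of_dvd_pow (n := 2) ⟨t, by linarith⟩
  obtain ⟨d, rfl⟩ := h3
  exact ⟨d, by ring⟩

/-- The five basis vectors. -/
theorem mat_ext5 {m n : Mat5} (h1 : m *ᵥ ![1, 0, 0, 0, 0] = n *ᵥ ![1, 0, 0, 0, 0])
    (h2 : m *ᵥ ![0, 1, 0, 0, 0] = n *ᵥ ![0, 1, 0, 0, 0])
    (h3 : m *ᵥ ![0, 0, 1, 0, 0] = n *ᵥ ![0, 0, 1, 0, 0])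
    (h4 : m *ᵥ ![0, 0, 0, 1, 0] = n *ᵥ ![0, 0, 0, 1, 0])
    (h5 : m *ᵥ ![0, 0, 0, 0, 1] = n *ᵥ ![0, 0, 0, 0, 1]) : m = n := by
  ext i j
  fin_cases j
  · simpa [Matrix.mulVec, dotProduct, Fin.sum_univ_five] using congrFun h1 i
  · simpa [Matrix.mulVec, dotProduct, Fin.sum_univ_five] using congrFun h2 i
  · simpa [Matrix.mulVec, dotProduct, Fin.sum_univ_five] using congrFun h3 i
  · simpa [Matrix.mulVec, dotProduct, Fin.sum_univ_five] using congrFun h4 i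
  · simpa [Matrix.mulVec, dotProduct, Fin.sum_univ_five] using congrFun h5 i

/-- The elementary matrices preserve the form. -/
theorem orth_elem (k : ℤ) : IsOrth (mX13 k) ∧ IsOrth (mX14 k) ∧ IsOrth (mH1 k) ∧
    IsOrth (mH3 k) := by
  refine ⟨?_, ?_, ?_, ?_⟩ <;> unfold IsOrth <;> ext i j <;> fin_cases i <;> fin_cases j <;>
    simp [mX13, mX14, mH1, mH3, matQ1, Matrix.mul_apply, Fin.sum_univ_five] <;> ring

/-- Every integral isometry lies in `H` up to a diagonal sign matrix. -/
theorem reduce_isometry {H : Subgroup (GL (Fin 5) ℤ)} (hH : Good H)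
    (hO : ∀ m, MemM H m → IsOrth m) (M : Mat5) (hM : IsOrth M) :
    ∃ m, MemM H m ∧ ∃ a b c : ℤˣ,
      m * M = Matrix.diagonal ![(a : ℤ), (a : ℤ), (b : ℤ), (b : ℤ), (c : ℤ)] := by
  -- first column
  have c1 := vec_eta (M *ᵥ ![1, 0, 0, 0, 0])
  have q1 := hM.bil _ _ c1 c1
  obtain ⟨m1, hm1, ε, hε⟩ := red_all hH _ _ _ _ ((M *ᵥ ![1, 0, 0, 0, 0]) 4)
    (show 8 * ((M *ᵥ ![1, 0, 0, 0, 0]) 0 * (M *ᵥ ![1, 0, 0, 0, 0]) 1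
      + (M *ᵥ ![1, 0, 0, 0, 0]) 2 * (M *ᵥ ![1, 0, 0, 0, 0]) 3) = _ by
      simp only [Matrix.cons_val] at q1
      linarith)
  rw [← c1, Matrix.mulVec_mulVec] at hε
  have hM1 : IsOrth (m1 * M) := (hO _ hm1).mul hM
  -- second column
  obtain ⟨m2, hm2, hM2, e21, e22⟩ : ∃ m, MemM H m ∧ IsOrth (m * M) ∧
      (m * M) *ᵥ ![1, 0, 0, 0, 0] = ![ε, 0, 0, 0, 0] ∧
      (m * M) *ᵥ ![0, 1, 0, 0, 0] = ![0, ε, 0, 0, 0] := by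
    obtain ⟨p, q, r, s, t, c2⟩ : ∃ p q r s t, (m1 * M) *ᵥ ![0, 1, 0, 0, 0] = ![p, q, r, s, t] :=
      ⟨_, _, _, _, _, vec_eta _⟩
    have b1 := hM1.bil _ _ hε c2
    have b2 := hM1.bil _ _ c2 c2
    simp at b1 b2
    have hεq : ε * q = 1 := by linarith
    have hqε : q = ε := by
      rcases Int.eq_one_or_neg_one_of_mul_eq_one hεq with h | h <;> subst h <;> linarith
    subst hqε
    obtain ⟨k, rfl⟩ := four_dvd_of_sq (h := t) (t := p * q + r * s) (by linarith)
    refine ⟨mH1 (-k * q) * (mX14 (q * r) * (mX13 (q * s) * m1)), (hH.H1 _).mul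
      ((hH.X14 _).mul ((hH.X13 _).mul hm1)), ?_, ?_, ?_⟩
    · simp only [mul_assoc]
      exact (orth_elem _).2.2.1.mul ((orth_elem _).2.1.mul ((orth_elem _).1.mul hM1))
    · simp only [mul_assoc, ← Matrix.mulVec_mulVec] at hε ⊢
      rw [hε, act_X13, act_X14, act_H1]; simp
    · simp only [mul_assoc, ← Matrix.mulVec_mulVec] at c2 ⊢
      rw [c2, act_X13, act_X14, act_H1]
      have w1 : s - q * s * q = 0 := by linear_combination -s * hεq
      have w2 : r - q * r * q = 0 := by linear_combination -r * hεq
      have w3 : 4 * k + 4 * (-k * q) * q = 0 := by linear_combination -4 * k * hεq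
      rw [w1, w2, w3]
      have w4 : p + q * s * r + q * r * 0 + -k * q * (4 * k) + 2 * (-k * q) ^ 2 * q = 0 := by
        have b3 : p * q + r * s = 2 * k ^ 2 := by linarith
        linear_combination q * b3 + (-p + 2 * k ^ 2 * q) * hεq
      rw [w4]
  have hεε : ε * ε = 1 := by
    have := hM2.bil _ _ e21 e22
    simp at this
    linarith
  -- third column
  obtain ⟨m3, hm3, hM3, g, e31, e32, e33⟩ : ∃ m, MemM H m ∧ IsOrth (m * M) ∧ ∃ g : ℤ,
      (m * M) *ᵥ ![1, 0, 0, 0, 0] = ![ε, 0, 0, 0, 0] ∧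
      (m * M) *ᵥ ![0, 1, 0, 0, 0] = ![0, ε, 0, 0, 0] ∧
      (m * M) *ᵥ ![0, 0, 1, 0, 0] = ![0, 0, g, 0, 0] := by
    obtain ⟨p, q, r, s, t, c3⟩ : ∃ p q r s t, (m2 * M) *ᵥ ![0, 0, 1, 0, 0] = ![p, q, r, s, t] :=
      ⟨_, _, _, _, _, vec_eta _⟩
    have b1 := hM2.bil _ _ e21 c3
    have b2 := hM2.bil _ _ e22 c3
    have b3 := hM2.bil _ _ c3 c3
    have hε0 : ε ≠ 0 := by rintro rfl; simp at hεε
    simp [hε0] at b1 b2 b3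
    subst b1 b2
    by_cases hr : r = 0
    · subst hr
      have ht : t = 0 := pow_eq_zero_iff (two_ne_zero) |>.1 (by linarith)
      subst ht
      refine ⟨mS34 * m2, hH.S34.mul hm2, ?_, s, ?_, ?_, ?_⟩
      · rw [mul_assoc]; exact (hO _ hH.S34).mul hM2
      · rw [mul_assoc, ← Matrix.mulVec_mulVec, e21, act_S34]
      · rw [mul_assoc, ← Matrix.mulVec_mulVec, e22, act_S34]
      · rw [mul_assoc, ← Matrix.mulVec_mulVec, c3, act_S34]
    · obtain ⟨m, hm, hst, g, hg⟩ := red_three hH _ r s t hr rfl (by linarith)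
      refine ⟨m * m2, hm.mul hm2, ?_, g, ?_, ?_, ?_⟩
      · rw [mul_assoc]; exact (hO _ hm).mul hM2
      · rw [mul_assoc, ← Matrix.mulVec_mulVec, e21, hst]
      · rw [mul_assoc, ← Matrix.mulVec_mulVec, e22, hst]
      · rw [mul_assoc, ← Matrix.mulVec_mulVec, c3, hg]
  -- fourth column
  have hε0 : ε ≠ 0 := by rintro rfl; simp at hεε
  obtain ⟨m4, hm4, hM4, hgg, e41, e42, e43, e44⟩ : ∃ m, MemM H m ∧ IsOrth (m * M) ∧ g * g = 1 ∧
      (m * M) *ᵥ ![1, 0, 0, 0, 0] = ![ε, 0, 0, 0, 0] ∧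
      (m * M) *ᵥ ![0, 1, 0, 0, 0] = ![0, ε, 0, 0, 0] ∧
      (m * M) *ᵥ ![0, 0, 1, 0, 0] = ![0, 0, g, 0, 0] ∧
      (m * M) *ᵥ ![0, 0, 0, 1, 0] = ![0, 0, 0, g, 0] := by
    obtain ⟨p, q, r, s, t, c4⟩ : ∃ p q r s t, (m3 * M) *ᵥ ![0, 0, 0, 1, 0] = ![p, q, r, s, t] :=
      ⟨_, _, _, _, _, vec_eta _⟩
    have b1 := hM3.bil _ _ e31 c4
    have b2 := hM3.bil _ _ e32 c4
    have b3 := hM3.bil _ _ e33 c4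
    have b4 := hM3.bil _ _ c4 c4
    simp [hε0] at b1 b2 b3 b4
    subst b1 b2
    have hgs : g * s = 1 := by linarith
    have hsg : s = g := by
      rcases Int.eq_one_or_neg_one_of_mul_eq_one hgs with h | h <;> subst h <;> linarith
    subst hsg
    obtain ⟨k, rfl⟩ := four_dvd_of_sq (h := t) (t := r * s) (by linarith)
    refine ⟨mH3 (-k * s) * m3, (hH.H3 _).mul hm3, ?_, hgs, ?_, ?_, ?_, ?_⟩
    · rw [mul_assoc]; exact (orth_elem _).2.2.2.mul hM3
    · rw [mul_assoc, ← Matrix.mulVec_mulVec, e31, act_H3]; simp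
    · rw [mul_assoc, ← Matrix.mulVec_mulVec, e32, act_H3]; simp
    · rw [mul_assoc, ← Matrix.mulVec_mulVec, e33, act_H3]; simp
    · rw [mul_assoc, ← Matrix.mulVec_mulVec, c4, act_H3]
      have w3 : 4 * k + 4 * (-k * s) * s = 0 := by linear_combination -4 * k * hgs
      have w4 : r + -k * s * (4 * k) + 2 * (-k * s) ^ 2 * s = 0 := by
        have b5 : r * s = 2 * k ^ 2 := by linarith
        linear_combination s * b5 + (-r + 2 * k ^ 2 * s) * hgs
      rw [w3, w4]
  -- fifth column
  have hg0 : g ≠ 0 := by rintro rfl; simp at hgg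
  obtain ⟨p, q, r, s, t, c5⟩ : ∃ p q r s t, (m4 * M) *ᵥ ![0, 0, 0, 0, 1] = ![p, q, r, s, t] :=
    ⟨_, _, _, _, _, vec_eta _⟩
  have b1 := hM4.bil _ _ e41 c5
  have b2 := hM4.bil _ _ e42 c5
  have b3 := hM4.bil _ _ e43 c5
  have b4 := hM4.bil _ _ e44 c5
  have b5 := hM4.bil _ _ c5 c5
  simp [hε0, hg0] at b1 b2 b3 b4 b5
  subst b1 b2 b3 b4
  have b6 : t * t = 1 := by linarith
  refine ⟨m4, hm4, Units.mkOfMulEqOne ε ε hεε, Units.mkOfMulEqOne g g hgg,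
    Units.mkOfMulEqOne t t b6, ?_⟩
  apply mat_ext5
  · rw [e41]; ext i; fin_cases i <;> simp [Matrix.mulVec_diagonal]
  · rw [e42]; ext i; fin_cases i <;> simp [Matrix.mulVec_diagonal]
  · rw [e43]; ext i; fin_cases i <;> simp [Matrix.mulVec_diagonal]
  · rw [e44]; ext i; fin_cases i <;> simp [Matrix.mulVec_diagonal]
  · rw [c5]; ext i; fin_cases i <;> simp [Matrix.mulVec_diagonal]

/-! ### Transport to the original coordinates -/

def matP : Mat5 :=
  !![-1, 1, 0, 0, 0; 0, 2, -1, 0, -1; 0, 1, 0, -1, -1; 1, 0, 0, -2, -1; 0, 0, 1, -1, 0]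
def matPi : Mat5 :=
  !![-1, 1, -1, 0, 1; 0, 1, -1, 0, 1; -1, 0, 1, -1, 1; -1, 0, 1, -1, 0; 1, 1, -3, 1, 1]

def unitP : GL (Fin 5) ℤ := ⟨matP, matPi, by decide, by decide⟩

def mA : Mat5 :=
  !![0, -1, -1, 0, 0; 0, -1, 0, -1, 0; 1, 1, -1, -1, -1; 0, 1, 0, 0, 0; 0, -4, 0, 0, 1]
def mB : Mat5 :=
  !![0, -1, 0, -1, 0; 0, -1, -1, 0, 0; 1, 1, -1, -1, -1; 0, 1, 0, 0, 0; 0, -4, 0, 0, 1]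
def mAi : Mat5 :=
  !![-1, -1, 1, 1, 1; 0, 0, 0, 1, 0; -1, 0, 0, -1, 0; 0, -1, 0, -1, 0; 0, 0, 0, 4, 1]
def mBi : Mat5 :=
  !![-1, -1, 1, 1, 1; 0, 0, 0, 1, 0; 0, -1, 0, -1, 0; -1, 0, 0, -1, 0; 0, 0, 0, 4, 1]

def mBA : Mat5 :=
  !![0, 0, 0, 1, 0; -1, 0, 1, 2, 1; -1, 0, 0, 0, 0; 0, -1, 0, -1, 0; 0, 0, 0, 4, 1]
def mABB : Mat5 :=
  !![2, 0, -2, -1, -1; 1, 1, -1, -1, -1; 0, 1, 0, 1, 0; -1, 0, 2, 1, 1; 4, 0, -4, -4, -3]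
def mBABA : Mat5 :=
  !![0, -1, 0, -1, 0; -1, -2, 0, 1, 1; 0, 0, 0, -1, 0; 1, 1, -1, -1, -1; 0, -4, 0, 0, 1]
def mABBABB : Mat5 :=
  !![1, -2, -2, -1, 0; 0, 0, -1, 0, 0; 0, 1, 1, 0, 0; 1, 2, 0, 0, -1; 0, -4, -4, 0, 1]
def mLeft : Mat5 :=
  !![-1, -2, 1, 0, 1; -1, -2, 0, 1, 1; -1, -2, 0, 0, 1; 1, 1, -1, -1, -1; 0, -4, 0, 0, 1]
def mRight : Mat5 :=
  !![-2, -2, 1, 4, 2; -1, -1, 1, 1, 1; 1, 0, -1, -2, -1; 0, 1, -1, -2, -1; -4, -4, 4, 8, 5]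

/-- A subgroup containing the two generators contains all elementary matrices. -/
theorem good_of_generators {H : Subgroup (GL (Fin 5) ℤ)} (ha : MemM H mA) (hb : MemM H mB) :
    Good H := by
  have hai : MemM H mAi := ha.inv (by decide)
  have hbi : MemM H mBi := hb.inv (by decide)
  have h14 : MemM H (mX14 (-1)) := by
    have h : mA * mA * mA = mX14 (-1) := by decide
    exact h ▸ (ha.mul ha).mul ha
  have hBA : MemM H mBA := by
    have h : mB * mA = mBA := by decide
    exact h ▸ hb.mul ha
  have hABB : MemM H mABB := by
    have h : mA * mB * mB = mABB := by decide
    exact h ▸ (ha.mul hb).mul hb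
  have hBABA : MemM H mBABA := by
    have h : mBA * mBA = mBABA := by decide
    exact h ▸ hBA.mul hBA
  have hABBABB : MemM H mABBABB := by
    have h : mABB * mABB = mABBABB := by decide
    exact h ▸ hABB.mul hABB
  have hLeft : MemM H mLeft := by
    have h : mX14 (-1) * mBABA = mLeft := by decide
    exact h ▸ h14.mul hBABA
  have hRight : MemM H mRight := by
    have h : mABBABB * mA = mRight := by decide
    exact h ▸ hABBABB.mul ha
  refine Good.of_four ?_ ?_ h14 ?_
  · have h : mA * mBi = mS12 := by decide
    exact h ▸ ha.mul hbi
  · have h : mAi * mB = mS34 := by decide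
    exact h ▸ hai.mul hb
  · have h : mLeft * mRight = mH3 1 := by decide
    exact h ▸ hLeft.mul hRight

/-- The form in the two coordinate systems. -/
theorem isOrth_conj {g : GL (Fin 5) ℤ} (hg : g ∈ orthogonalSubgroup matQ) :
    IsOrth (matPi * (g : Mat5) * matP) := by
  have hg1 : (g : Mat5)ᵀ * matQ * (g : Mat5) = matQ := hg
  have h1 : matQ1 = matPᵀ * matQ * matP := by decide
  have h2 : matP * matPi = 1 := by decide
  have h3 : matPiᵀ * matPᵀ = 1 := by decide
  unfold IsOrth
  calc (matPi * (g : Mat5) * matP)ᵀ * matQ1 * (matPi * (g : Mat5) * matP)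
      = matPᵀ * ((g : Mat5)ᵀ * (matPiᵀ * matPᵀ) * matQ * (matP * matPi) * (g : Mat5)) * matP := by
        rw [h1]; simp only [Matrix.transpose_mul, mul_assoc]
    _ = matQ1 := by rw [h2, h3, mul_one, mul_one, hg1, h1]

/-- Case 7 of Theorem 1.2: the hypergeometric group `Γ(f,g)` generated by the companion matrices `A`, `B`
of `f(x) = x^5 + x^4 + x^3 - x^2 - x - 1` and `g(x) = x^5 + x^4 + x + 1`
is an arithmetic subgroup of `O_Q(ℤ)`: it preserves `Q`, it is contained in `O_Q(ℤ)`,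
and it has finite index in `O_Q(ℤ)`. -/
theorem hypergeometric_group_arithmetic
    (A B : GL (Fin 5) ℤ)
    (hA : (A : Matrix (Fin 5) (Fin 5) ℤ) = matA)
    (hB : (B : Matrix (Fin 5) (Fin 5) ℤ) = matB) :
    matAᵀ * matQ * matA = matQ ∧
    matBᵀ * matQ * matB = matQ ∧
    Subgroup.closure {A, B} ≤ orthogonalSubgroup matQ ∧
    ((Subgroup.closure {A, B}).subgroupOf (orthogonalSubgroup matQ)).FiniteIndex := by
  have hA1 : matAᵀ * matQ * matA = matQ := by decide
  have hB1 : matBᵀ * matQ * matB = matQ := by decide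
  have hle : Subgroup.closure {A, B} ≤ orthogonalSubgroup matQ := by
    rw [Subgroup.closure_le]
    rintro g (rfl | rfl)
    · change (g : Matrix (Fin 5) (Fin 5) ℤ)ᵀ * matQ * (g : Matrix (Fin 5) (Fin 5) ℤ) = matQ
      rw [hA, hA1]
    · change (g : Matrix (Fin 5) (Fin 5) ℤ)ᵀ * matQ * (g : Matrix (Fin 5) (Fin 5) ℤ) = matQ
      rw [hB, hB1]
  refine ⟨hA1, hB1, hle, ?_⟩
  -- the group in the new coordinates
  let H : Subgroup (GL (Fin 5) ℤ) :=
    (Subgroup.closure {A, B}).comap (MulAut.conj unitP).toMonoidHom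
  have memH : ∀ g : GL (Fin 5) ℤ, g ∈ H ↔ unitP * g * unitP⁻¹ ∈ Subgroup.closure {A, B} :=
    fun g => Iff.rfl
  have conj_mem : ∀ g ∈ Subgroup.closure {A, B}, unitP⁻¹ * g * unitP ∈ H := by
    intro g hg
    rw [memH]
    simpa [mul_assoc] using hg
  have hP : (unitP : Mat5) = matP := rfl
  have hPi : ((unitP⁻¹ : GL (Fin 5) ℤ) : Mat5) = matPi := rfl
  have hgood : Good H := by
    apply good_of_generators
    · refine ⟨_, conj_mem A (Subgroup.subset_closure (by simp)), ?_⟩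
      rw [Units.val_mul, Units.val_mul, hA, hP, hPi]
      decide
    · refine ⟨_, conj_mem B (Subgroup.subset_closure (by simp)), ?_⟩
      rw [Units.val_mul, Units.val_mul, hB, hP, hPi]
      decide
  have hO : ∀ m, MemM H m → IsOrth m := by
    rintro m ⟨g, hg, rfl⟩
    have := isOrth_conj (hle ((memH g).1 hg))
    rw [← hP, ← hPi, ← Units.val_mul, ← Units.val_mul] at this
    simpa [mul_assoc] using this
  -- every isometry is, up to the group, one of finitely many sign matrices
  have key : ∀ g : orthogonalSubgroup matQ, ∃ s : ℤˣ × ℤˣ × ℤˣ, ∃ γ ∈ H,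
      ((γ * (unitP⁻¹ * (g : GL (Fin 5) ℤ)⁻¹ * unitP) : GL (Fin 5) ℤ) : Mat5) =
        Matrix.diagonal ![(s.1 : ℤ), (s.1 : ℤ), (s.2.1 : ℤ), (s.2.1 : ℤ), (s.2.2 : ℤ)] := by
    intro g
    obtain ⟨m, ⟨γ, hγ, rfl⟩, a, b, c, h⟩ := reduce_isometry hgood hO _
      (isOrth_conj ((orthogonalSubgroup matQ).inv_mem g.2))
    refine ⟨(a, b, c), γ, hγ, ?_⟩
    rw [← h, ← hP, ← hPi]
    simp only [Units.val_mul]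
  choose s γ hγ hs using key
  let K := (Subgroup.closure {A, B}).subgroupOf (orthogonalSubgroup matQ)
  have hinj : Function.Injective (fun q : orthogonalSubgroup matQ ⧸ K => s q.out) := by
    intro q q1 hq
    simp only at hq
    have e : γ q.out * (unitP⁻¹ * (q.out : GL (Fin 5) ℤ)⁻¹ * unitP) =
        γ q1.out * (unitP⁻¹ * (q1.out : GL (Fin 5) ℤ)⁻¹ * unitP) := by
      apply Units.ext
      rw [hs, hs, hq]
    rw [← q.out_eq, ← q1.out_eq]
    apply QuotientGroup.eq.2
    rw [Subgroup.mem_subgroupOf]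
    have e1 := H.mul_mem (H.inv_mem (hγ q.out)) (hγ q1.out)
    rw [memH] at e1
    convert e1 using 1
    have e2 : (γ q.out)⁻¹ * γ q1.out = (unitP⁻¹ * (q.out : GL (Fin 5) ℤ)⁻¹ * unitP) *
        (unitP⁻¹ * (q1.out : GL (Fin 5) ℤ)⁻¹ * unitP)⁻¹ := by
      rw [inv_mul_eq_iff_eq_mul, ← mul_assoc, e, mul_assoc, mul_inv_cancel, mul_one]
    rw [e2]
    simp [mul_assoc]
  haveI : Finite (orthogonalSubgroup matQ ⧸ K) := Finite.of_injective _ hinj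
  exact Subgroup.finiteIndex_of_finite_quotient
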